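/- For every 0 ≤ q < p ≤ n and all natural numbers z₁, z₂ with z₁ + a z₂ ≡ i_q − i_p (mod r), there is a path in the labelled quiver from vertex p to vertex q with total label (z₁, z₂). (Every map S_{i_p} → S_{i_q} with q < p can be seen in the diagram of special Cohen–Macaulay modules.) -/

import Mathlib

/-- The two-step linear recursion `s₀ = x0`, `s₁ = x1`, `s_{t+1} = α_t s_t − s_{t−1}`;
with `x0 = r, x1 = a` this is the i-series and with `x0 = 0, x1 = 1` the j-series. -/
def ser (x0 x1 : ℤ) (α : ℕ → ℕ) : ℕ → ℤ
  | 0 => x0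
  | 1 => x1
  | t + 2 => (α (t + 1) : ℤ) * ser x0 x1 α (t + 1) - ser x0 x1 α t

/-- Hirzebruch–Jung (negative) continued fraction value of a list. -/
def hj : List ℚ → ℚ
  | [] => 0
  | q :: L => q - 1 / hj L

/-- `Arrow r a n α v w ℓ` : there is an arrow `v → w` with label `ℓ = (ℓ₁, ℓ₂)` in the
labelled quiver of the diagram of special CM modules: clockwise arrows `t → t−1` with
label `(i_{t−1} − i_t, 0)` and `0 → n` with label `(1,0)`; anticlockwise arrows
`t → t+1` with label `(0, j_{t+1} − j_t)` and `n → 0` with label `(0, r − jₙ)`; and for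
`1 ≤ t ≤ n`, `1 ≤ s ≤ α_t − 2`, extra arrows `t → 0` with label
`(i_{t−1} − (s+1) i_t, s j_t − j_{t−1})`. -/
def Arrow (r a n : ℕ) (α : ℕ → ℕ) (v w : ℕ) (ℓ : ℕ × ℕ) : Prop :=
  (∃ t, 1 ≤ t ∧ t ≤ n ∧ v = t ∧ w = t - 1 ∧
    ℓ = ((ser r a α (t - 1) - ser r a α t).toNat, 0)) ∨
  (v = 0 ∧ w = n ∧ ℓ = (1, 0)) ∨
  (∃ t, t + 1 ≤ n ∧ v = t ∧ w = t + 1 ∧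
    ℓ = (0, (ser 0 1 α (t + 1) - ser 0 1 α t).toNat)) ∨
  (v = n ∧ w = 0 ∧ ℓ = (0, ((r : ℤ) - ser 0 1 α n).toNat)) ∨
  (∃ t s, 1 ≤ t ∧ t ≤ n ∧ 1 ≤ s ∧ s ≤ α t - 2 ∧ v = t ∧ w = 0 ∧
    ℓ = ((ser r a α (t - 1) - ((s : ℤ) + 1) * ser r a α t).toNat,
         ((s : ℤ) * ser 0 1 α t - ser 0 1 α (t - 1)).toNat))

/-- One step of the labelled quiver: move along an arrow, adding its label to the
running total. -/
def StepQ (r a n : ℕ) (α : ℕ → ℕ) (x y : ℕ × ℕ × ℕ) : Prop :=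
  ∃ ℓ : ℕ × ℕ, Arrow r a n α x.1 y.1 ℓ ∧ y.2.1 = x.2.1 + ℓ.1 ∧ y.2.2 = x.2.2 + ℓ.2

/-- There is a path from vertex `p` to vertex `q` with total label `(z₁, z₂)`. -/
def HasPath (r a n : ℕ) (α : ℕ → ℕ) (p q z₁ z₂ : ℕ) : Prop :=
  Relation.ReflTransGen (StepQ r a n α) (p, 0, 0) (q, z₁, z₂)

theorem ser_succ_succ (x0 x1 : ℤ) (α : ℕ → ℕ) (t : ℕ) :
    ser x0 x1 α (t + 2) = (α (t + 1) : ℤ) * ser x0 x1 α (t + 1) - ser x0 x1 α t := rfl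

theorem ser_succ_eq_shift (x0 x1 : ℤ) (α : ℕ → ℕ) (t : ℕ) :
    ser x0 x1 α (t + 1) = ser x1 ((α 1 : ℤ) * x1 - x0) (fun k => α (k + 1)) t := by
  induction t using Nat.twoStepInduction with
  | zero => rfl
  | one => rfl
  | more t ih₁ ih₂ =>
    rw [ser_succ_succ x0 x1 α (t + 1), ser_succ_succ x1, ih₁, ih₂]

/-- A negative continued fraction with all entries at least `2` is `0` (if empty) or exceeds `1`. -/
theorem hj_eq_zero_or_one_lt (L : List ℚ) (hL : ∀ q ∈ L, 2 ≤ q) :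
    (L = [] ∧ hj L = 0) ∨ 1 < hj L := by
  induction L with
  | nil => exact Or.inl ⟨rfl, rfl⟩
  | cons q L ih =>
    right
    have hq : 2 ≤ q := hL q (by simp)
    rw [hj]
    rcases ih fun x hx => hL x (by simp [hx]) with ⟨-, h⟩ | h
    · rw [h]; norm_num; linarith
    · have : 1 / hj L < 1 := by rw [div_lt_one] <;> linarith
      linarith

/-- If the continued fraction of length `n` equals `x0 / x1`, the associated series strictly
decreases and reaches `0` at index `n + 1`. -/
theorem ser_eq_zero_and_strict_anti (n : ℕ) : ∀ (α : ℕ → ℕ) (x0 x1 : ℤ), 0 < x0 → 0 ≤ x1 →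
    (∀ t, 1 ≤ t → t ≤ n → 2 ≤ α t) →
    hj ((List.range n).map fun t => (α (t + 1) : ℚ)) = (x0 : ℚ) / (x1 : ℚ) →
    ser x0 x1 α (n + 1) = 0 ∧ ∀ t ≤ n, ser x0 x1 α (t + 1) < ser x0 x1 α t := by
  induction n with
  | zero =>
    intro α x0 x1 h0 h1 _ hv
    have h0' : (x0 : ℚ) ≠ 0 := by exact_mod_cast h0.ne'
    have hx1 : x1 = 0 := by
      simpa [hj, h0.ne'] using hv.symm
    subst hx1
    refine ⟨rfl, fun t ht => ?_⟩
    obtain rfl : t = 0 := by omega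
    exact h0
  | succ n ih =>
    intro α x0 x1 h0 h1 hα hv
    have hmem : ∀ q ∈ ((List.range (n + 1)).map fun t => (α (t + 1) : ℚ)), (2 : ℚ) ≤ q := by
      intro q hq
      obtain ⟨t, ht, rfl⟩ := List.mem_map.1 hq
      have := hα (t + 1) (by omega) (by have := List.mem_range.1 ht; omega)
      exact_mod_cast this
    have hgt : 1 < (x0 : ℚ) / x1 := by
      rw [← hv]
      rcases hj_eq_zero_or_one_lt _ hmem with ⟨h, -⟩ | h
      · simp at h
      · exact h
    have hx1 : 0 < x1 := by
      rcases h1.eq_or_lt with h | h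
      · rw [← h] at hgt; norm_num at hgt
      · exact h
    have hx1' : (0 : ℚ) < x1 := by exact_mod_cast hx1
    have hlt : x1 < x0 := by
      rw [lt_div_iff₀ hx1', one_mul] at hgt
      exact_mod_cast hgt
    rw [List.range_succ_eq_map, List.map_cons, List.map_map] at hv
    rw [List.range_succ_eq_map, List.map_cons, List.map_map] at hmem
    rw [hj] at hv
    set L := List.map ((fun t => (α (t + 1) : ℚ)) ∘ Nat.succ) (List.range n) with hL
    have hLnn : 0 ≤ hj L := by
      rcases hj_eq_zero_or_one_lt L fun x hx => hmem x (by simp [hx]) with ⟨-, h⟩ | h <;> linarith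
    have hinv : 1 / hj L = (((α 1 : ℤ) * x1 - x0 : ℤ) : ℚ) / x1 := by
      push_cast
      rw [sub_div, mul_div_cancel_right₀ _ hx1'.ne', ← hv]
      simp
    have hx2 : 0 ≤ (α 1 : ℤ) * x1 - x0 := by
      have h : 0 ≤ 1 / hj L := by positivity
      rw [hinv, le_div_iff₀ hx1', zero_mul] at h
      exact_mod_cast h
    have hv' : hj L = (x1 : ℚ) / (((α 1 : ℤ) * x1 - x0 : ℤ) : ℚ) := by
      rw [← inv_div, ← hinv, one_div, inv_inv]
    obtain ⟨h₁, h₂⟩ := ih (fun k => α (k + 1)) x1 ((α 1 : ℤ) * x1 - x0) hx1 hx2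
      (fun t ht htn => hα (t + 1) (by omega) (by omega)) hv'
    refine ⟨by rw [ser_succ_eq_shift]; exact h₁, fun t ht => ?_⟩
    cases t with
    | zero => exact hlt
    | succ t =>
      rw [ser_succ_eq_shift, ser_succ_eq_shift x0 x1 α t]
      exact h₂ t (by omega)

theorem ser_zero_one_mono (n : ℕ) (α : ℕ → ℕ) (hα : ∀ t, 1 ≤ t → t ≤ n → 2 ≤ α t) :
    ∀ t ≤ n, 0 ≤ ser 0 1 α t ∧ ser 0 1 α t < ser 0 1 α (t + 1) := by
  intro t
  induction t with
  | zero => intro _; simp [ser]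
  | succ t ih =>
    intro ht
    obtain ⟨h₁, h₂⟩ := ih (by omega)
    have h : (2 : ℤ) ≤ α (t + 1) := by exact_mod_cast hα (t + 1) (by omega) ht
    rw [ser_succ_succ]
    constructor <;> nlinarith

theorem ser_det (r a : ℤ) (α : ℕ → ℕ) (t : ℕ) :
    ser r a α t * ser 0 1 α (t + 1) - ser r a α (t + 1) * ser 0 1 α t = r := by
  induction t with
  | zero => simp [ser]
  | succ t ih => rw [ser_succ_succ, ser_succ_succ]; linear_combination ih

theorem dvd_ser_sub (r a : ℤ) (α : ℕ → ℕ) (t : ℕ) :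
    r ∣ ser r a α t - a * ser 0 1 α t := by
  induction t using Nat.twoStepInduction with
  | zero => simp [ser]
  | one => simp [ser]
  | more t ih₁ ih₂ =>
    rw [ser_succ_succ, ser_succ_succ]
    have h : (α (t + 1) : ℤ) * ser r a α (t + 1) - ser r a α t -
        a * ((α (t + 1) : ℤ) * ser 0 1 α (t + 1) - ser 0 1 α t) =
        α (t + 1) * (ser r a α (t + 1) - a * ser 0 1 α (t + 1)) -
          (ser r a α t - a * ser 0 1 α t) := by ring
    rw [h]
    exact dvd_sub (dvd_mul_of_dvd_right ih₂ _) ih₁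

/-- The vectors `(i, -j)` and `(i', -j')` span the lattice `x + a y ≡ 0 (mod r)`. -/
theorem exists_lattice_coords {r a i i' j j' x y : ℤ} (hr : r ≠ 0) (hdet : i * j' - i' * j = r)
    (hi : r ∣ i - a * j) (hi' : r ∣ i' - a * j') (h : r ∣ x + a * y) :
    ∃ A B : ℤ, x = A * i + B * i' ∧ y = -(A * j) - B * j' := by
  obtain ⟨k, hk⟩ := hi
  obtain ⟨k', hk'⟩ := hi'
  obtain ⟨m, hm⟩ := h
  refine ⟨j' * m + y * k', -(j * m + y * k), ?_, ?_⟩ <;> apply mul_left_cancel₀ hr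
  · linear_combination (-x) * hdet + (y * i) * hk' - (y * i') * hk + (i * j' - i' * j) * hm
  · linear_combination (-y) * hdet - (y * j) * hk' + (y * j') * hk

/-- A monomial of weight `i` is divisible by `x ^ i` or by `y ^ j`. -/
theorem le_or_le_of_weight {r a i i' j j' x y : ℤ} (hr : r ≠ 0) (hdet : i * j' - i' * j = r)
    (hdi : r ∣ i - a * j) (hdi' : r ∣ i' - a * j') (hi' : 0 ≤ i') (hii : i' < i)
    (hj : 0 ≤ j) (hjj : j < j') (hx : 0 ≤ x) (hy : 0 ≤ y) (h : r ∣ x + a * y - i) :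
    i ≤ x ∨ j ≤ y := by
  by_contra! hc
  obtain ⟨h₁, h₂⟩ := hc
  obtain ⟨A, B, hA, hB⟩ := exists_lattice_coords (x := x - i) (y := y) hr hdet hdi hdi'
    (by rwa [show x - i + a * y = x + a * y - i by ring])
  rcases lt_or_ge B 0 with hB0 | hB0
  · have : 0 < A + B + 1 := by
      by_contra! hcon
      nlinarith
    nlinarith
  · have hA1 : A + 1 ≤ 0 := by
      by_contra! hcon
      nlinarith
    have hs : 0 ≤ A + B + 1 := by
      by_contra! hcon
      nlinarith
    rcases hB0.eq_or_lt with rfl | hB0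
    · obtain rfl : A = -1 := by linarith
      linarith
    · have : A + B < 0 := by
        by_contra! hcon
        nlinarith
      obtain rfl : A = -1 - B := by linarith
      nlinarith

/-- A nonconstant invariant monomial is divisible by `x ^ (i - i')` or by `y ^ j`. -/
theorem eq_zero_of_invariant {r a i i' j j' x y : ℤ} (hr : r ≠ 0) (hdet : i * j' - i' * j = r)
    (hdi : r ∣ i - a * j) (hdi' : r ∣ i' - a * j') (hi' : 0 ≤ i') (hii : i' < i)
    (hj : 0 < j) (hjj : j < j') (hx : 0 ≤ x) (hy : 0 ≤ y) (h : r ∣ x + a * y)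
    (hxi : x < i - i') (hyj : y < j) : x = 0 ∧ y = 0 := by
  obtain ⟨A, B, hA, hB⟩ := exists_lattice_coords hr hdet hdi hdi' h
  have hA0 : A = 0 := by
    rcases lt_trichotomy A 0 with hA0 | hA0 | hA0
    · exfalso
      have : 0 < A + B := by
        by_contra! hcon
        nlinarith
      nlinarith
    · exact hA0
    · exfalso
      rcases lt_or_ge (A + B) 0 with hs | hs <;> nlinarith
  have hB0 : B = 0 := by
    subst hA0
    rcases lt_trichotomy B 0 with hB0 | hB0 | hB0
    · nlinarith
    · exact hB0
    · nlinarith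
  simp [hA, hB, hA0, hB0]

/-- A monomial of weight `-i` divisible by neither `x ^ (i₋ - i)` nor `y ^ (j₊ - j)` is
the label of an extra arrow; here `(i₋, i, i₊)` and `(j₋, j, j₊)` are consecutive series terms. -/
theorem exists_extra_label {r a c i₀ i j₀ j x y : ℤ} (hr : r ≠ 0) (hdet : i₀ * j - i * j₀ = r)
    (hdi₀ : r ∣ i₀ - a * j₀) (hdi : r ∣ i - a * j) (hc : 2 ≤ c) (hi0 : 0 < i)
    (hi : c * i - i₀ < i) (hii : i < i₀) (hj₀ : 0 ≤ j₀) (hjj : j₀ < j)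
    (hx : 0 ≤ x) (hy : 0 ≤ y) (h : r ∣ x + a * y + i)
    (hxi : x < i₀ - i) (hyj : y < (c * j - j₀) - j) :
    ∃ s : ℤ, 1 ≤ s ∧ s ≤ c - 2 ∧ x = i₀ - (s + 1) * i ∧ y = s * j - j₀ := by
  obtain ⟨A, B, hA, hB⟩ := exists_lattice_coords (x := x + i) (y := y) hr hdet hdi₀ hdi
    (by rwa [show x + i + a * y = x + a * y + i by ring])
  obtain ⟨s, rfl⟩ : ∃ s, B = -s := ⟨-B, by ring⟩
  have hA1 : 1 ≤ A := by
    by_contra! hcon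
    have : s + 1 ≤ A := by
      by_contra! hcon
      nlinarith
    nlinarith
  have hA2 : A ≤ 1 := by
    by_contra! hcon
    have h₁ : s ≤ A + c - 3 := by
      by_contra! hcon'
      nlinarith
    have h₂ : (A - 1) * (c - 1) + 1 ≤ s := by
      by_contra! hcon'
      nlinarith
    nlinarith
  obtain rfl : A = 1 := le_antisymm hA2 hA1
  refine ⟨s, ?_, ?_, by linear_combination hA, by linear_combination hB⟩
  · by_contra! hcon
    nlinarith
  · by_contra! hcon
    nlinarith

theorem HasPath.trans {r a n : ℕ} {α : ℕ → ℕ} {p m q z₁ z₂ w₁ w₂ : ℕ}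
    (h : HasPath r a n α p m z₁ z₂) (h' : HasPath r a n α m q w₁ w₂) :
    HasPath r a n α p q (z₁ + w₁) (z₂ + w₂) := by
  refine Relation.ReflTransGen.trans h ?_
  refine Relation.ReflTransGen.lift
    (fun x : ℕ × ℕ × ℕ => (x.1, z₁ + x.2.1, z₂ + x.2.2)) ?_ _ _ h'
  rintro x y ⟨ℓ, hℓ, h₁, h₂⟩
  exact ⟨ℓ, hℓ, by simp only [h₁, add_assoc], by simp only [h₂, add_assoc]⟩

theorem HasPath.of_arrow {r a n : ℕ} {α : ℕ → ℕ} {p q : ℕ} {ℓ : ℕ × ℕ}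
    (h : Arrow r a n α p q ℓ) : HasPath r a n α p q ℓ.1 ℓ.2 :=
  Relation.ReflTransGen.single ⟨ℓ, h, by simp, by simp⟩

/-- Every monomial map between two special Cohen–Macaulay modules is a path in the quiver. -/
theorem hasPath_of_dvd (r a n : ℕ) (α : ℕ → ℕ)
    (ha : 1 ≤ a) (har : a < r) (hcop : Nat.Coprime r a) (hn : 1 ≤ n)
    (hα : ∀ t, 1 ≤ t → t ≤ n → 2 ≤ α t)
    (hval : hj ((List.range n).map fun t => (α (t + 1) : ℚ)) = (r : ℚ) / (a : ℚ)) (N : ℕ) :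
    ∀ p q z₁ z₂ : ℕ, z₁ + z₂ = N → p ≤ n → q ≤ n →
      (r : ℤ) ∣ z₁ + a * z₂ - (ser r a α q - ser r a α p) → HasPath r a n α p q z₁ z₂ := by
  have hr : (0 : ℤ) < r := by omega
  obtain ⟨hI0, hIlt⟩ := ser_eq_zero_and_strict_anti n α r a hr (by positivity) hα
    (by simpa using hval)
  have hJ := ser_zero_one_mono n α hα
  have hdet := ser_det r a α
  have hdvd := dvd_ser_sub r a α
  have hInn : ∀ t ≤ n, 0 ≤ ser r a α (t + 1) := by
    intro t ht
    induction ht using Nat.decreasingInduction with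
    | self => exact hI0.ge
    | of_succ k hk ih => exact (ih.trans_lt (hIlt (k + 1) hk)).le
  have hJpos : ∀ t, 1 ≤ t → t ≤ n → 0 < ser 0 1 α t := by
    intro t ht htn
    obtain ⟨t, rfl⟩ := Nat.exists_eq_add_of_le' ht
    exact (hJ t (by omega)).1.trans_lt (hJ t (by omega)).2
  have hJr : ser 0 1 α (n + 1) = r := by
    have h₁ : (r : ℤ) ∣ a * ser 0 1 α (n + 1) := by
      simpa [hI0] using hdvd (n + 1)
    have h₂ := Int.le_of_dvd ((hJ n le_rfl).1.trans_lt (hJ n le_rfl).2)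
      ((Nat.isCoprime_iff_coprime.2 hcop).dvd_of_dvd_mul_left h₁)
    have h₃ := hdet n
    rw [hI0] at h₃
    have h₄ := hIlt n le_rfl
    rw [hI0] at h₄
    nlinarith
  have hI1 : ser r a α n = 1 := by
    have h := hdet n
    rw [hI0, hJr] at h
    nlinarith
  induction N using Nat.strong_induction_on with
  | _ N ih =>
  intro p q z₁ z₂ hN hp hq hz
  have first : ∀ (m : ℕ) (u v : ℤ), m ≤ n → 0 ≤ u → 0 ≤ v → 0 < u + v → u ≤ z₁ → v ≤ z₂ →
      (r : ℤ) ∣ u + a * v - (ser r a α m - ser r a α p) →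
      Arrow r a n α p m (u.toNat, v.toNat) → HasPath r a n α p q z₁ z₂ := by
    intro m u v hm hu hv huv hu' hv' hd h
    lift u to ℕ using hu
    lift v to ℕ using hv
    obtain ⟨w₁, rfl⟩ := Nat.exists_eq_add_of_le (show u ≤ z₁ by omega)
    obtain ⟨w₂, rfl⟩ := Nat.exists_eq_add_of_le (show v ≤ z₂ by omega)
    refine HasPath.trans (HasPath.of_arrow h)
      (ih (w₁ + w₂) (by omega) m q w₁ w₂ rfl hm hq ?_)
    exact (dvd_sub hz hd).trans (Eq.dvd (by push_cast; ring))
  have last : ∀ (m : ℕ) (u v : ℤ), m ≤ n → 0 ≤ u → 0 ≤ v → 0 < u + v → u ≤ z₁ → v ≤ z₂ →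
      (r : ℤ) ∣ u + a * v - (ser r a α q - ser r a α m) →
      Arrow r a n α m q (u.toNat, v.toNat) → HasPath r a n α p q z₁ z₂ := by
    intro m u v hm hu hv huv hu' hv' hd h
    lift u to ℕ using hu
    lift v to ℕ using hv
    obtain ⟨w₁, rfl⟩ := Nat.exists_eq_add_of_le' (show u ≤ z₁ by omega)
    obtain ⟨w₂, rfl⟩ := Nat.exists_eq_add_of_le' (show v ≤ z₂ by omega)
    refine HasPath.trans (ih (w₁ + w₂) (by omega) p m w₁ w₂ rfl hp hm ?_) (HasPath.of_arrow h)
    exact (dvd_sub hz hd).trans (Eq.dvd (by push_cast; ring))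
  have hS0 : ser r a α 0 = r := rfl
  have hz₁ : (0 : ℤ) ≤ z₁ := by positivity
  have hz₂ : (0 : ℤ) ≤ z₂ := by positivity
  -- The weight of an anticlockwise arrow.
  have hup : ∀ t, (r : ℤ) ∣ 0 + a * (ser 0 1 α (t + 1) - ser 0 1 α t) -
      (ser r a α (t + 1) - ser r a α t) := by
    intro t
    exact (dvd_sub (hdvd t) (hdvd (t + 1))).trans (Eq.dvd (by ring))
  have hwrap : (r : ℤ) ∣ ser r a α 0 - ser r a α (n + 1) := by simp [hS0, hI0]
  rcases Nat.eq_zero_or_pos q with rfl | hq0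
  · rcases Nat.eq_zero_or_pos p with rfl | hp0
    · rcases Nat.eq_zero_or_pos z₁ with rfl | hz₁0
      · rcases Nat.eq_zero_or_pos z₂ with rfl | hz₂0
        · exact Relation.ReflTransGen.refl
        · refine first 1 0 1 hn le_rfl zero_le_one (by simp) (by simp) (by omega) ?_ ?_
          · simp [ser]
          · exact Or.inr (Or.inr (Or.inl ⟨0, hn, rfl, rfl, by simp [ser]⟩))
      · refine first n 1 0 le_rfl zero_le_one le_rfl (by simp) (by omega) (by simp) ?_ ?_
        · simp [hI1, hS0]
        · exact Or.inr (Or.inl ⟨rfl, rfl, rfl⟩)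
    · obtain ⟨t, rfl⟩ := Nat.exists_eq_add_of_le' hp0
      have hlt := hIlt t (by omega)
      have hlt' := hIlt (t + 1) hp
      have hJt := hJ t (by omega)
      have hJt' := hJ (t + 1) hp
      have hc : (2 : ℤ) ≤ α (t + 1) := by exact_mod_cast hα (t + 1) hp0 hp
      by_cases hx : ser r a α t - ser r a α (t + 1) ≤ z₁
      · refine first t _ 0 (by omega) (by linarith) le_rfl (by linarith) hx hz₂ (by simp) ?_
        exact Or.inl ⟨t + 1, hp0, hp, rfl, rfl, rfl⟩
      by_cases hy : ser 0 1 α (t + 2) - ser 0 1 α (t + 1) ≤ z₂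
      · rcases hp.eq_or_lt with rfl | hpn
        · refine first 0 0 _ (by omega) le_rfl (by linarith) (by linarith) hz₁ hy ?_ ?_
          · exact (dvd_sub (hup (t + 1)) hwrap).trans (Eq.dvd (by ring))
          · refine Or.inr (Or.inr (Or.inr (Or.inl ⟨rfl, rfl, ?_⟩)))
            rw [hJr]
            rfl
        · refine first (t + 2) 0 _ hpn le_rfl (by linarith) (by linarith) hz₁ hy (hup _) ?_
          exact Or.inr (Or.inr (Or.inl ⟨t + 1, hpn, rfl, rfl, rfl⟩))
      push Not at hx hy
      obtain ⟨s, hs₁, hs₂, hu, hv⟩ := exists_extra_label (c := α (t + 1)) hr.ne' (hdet t)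
        (hdvd t) (hdvd (t + 1)) hc ((hInn (t + 1) hp).trans_lt hlt') hlt' hlt hJt.1 hJt.2
        hz₁ hz₂ ((dvd_add hz (dvd_refl (r : ℤ))).trans (Eq.dvd (by rw [hS0]; ring))) hx hy
      lift s to ℕ using by omega
      refine Relation.ReflTransGen.single ⟨(z₁, z₂), ?_, by simp, by simp⟩
      refine Or.inr (Or.inr (Or.inr (Or.inr
        ⟨t + 1, s, hp0, hp, by omega, by omega, rfl, rfl, ?_⟩)))
      simp only [Nat.add_sub_cancel, ← hu, ← hv, Int.toNat_natCast]
  · obtain ⟨t, rfl⟩ := Nat.exists_eq_add_of_le' hq0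
    have hlt := hIlt t (by omega)
    have hlt' := hIlt (t + 1) hq
    have hJt := hJ t (by omega)
    have hJt' := hJ (t + 1) hq
    have hI' := hInn (t + 1) hq
    by_cases hx : ser r a α (t + 1) - ser r a α (t + 2) ≤ z₁
    · rcases hq.eq_or_lt with rfl | hqn
      · rw [hI0, hI1] at hx
        refine last 0 1 0 (by omega) zero_le_one le_rfl (by simp) (by simpa using hx) hz₂ ?_ ?_
        · simp [hI1, hS0]
        · exact Or.inr (Or.inl ⟨rfl, rfl, rfl⟩)
      · refine last (t + 2) _ 0 hqn (by linarith) le_rfl (by linarith) hx hz₂ (by simp) ?_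
        exact Or.inl ⟨t + 2, by omega, hqn, rfl, rfl, rfl⟩
    by_cases hy : ser 0 1 α (t + 1) - ser 0 1 α t ≤ z₂
    · refine last t 0 _ (by omega) le_rfl (by linarith) (by linarith) hz₁ hy (hup t) ?_
      exact Or.inr (Or.inr (Or.inl ⟨t, hq, rfl, rfl, rfl⟩))
    push Not at hx hy
    have hIanti : ∀ k l, k ≤ l → l ≤ n → ser r a α l ≤ ser r a α k := by
      intro k l hkl hl
      induction l, hkl using Nat.le_induction with
      | base => exact le_rfl
      | succ l _ ihl => exact (hIlt l (by omega)).le.trans (ihl (by omega))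
    have hJmono : ∀ k l, k ≤ l → l ≤ n → ser 0 1 α k ≤ ser 0 1 α l := by
      intro k l hkl hl
      induction l, hkl using Nat.le_induction with
      | base => exact le_rfl
      | succ l _ ihl => exact (ihl (by omega)).trans (hJ l (by omega)).2.le
    have special := fun (x y : ℤ) => le_or_le_of_weight (x := x) (y := y) hr.ne' (hdet (t + 1))
      (hdvd (t + 1)) (hdvd (t + 2)) hI' hlt' hJt'.1 hJt'.2
    rcases lt_trichotomy p (t + 1) with hpq | rfl | hpq
    · exfalso
      have hJp := hJmono p t (by omega) (by omega)
      have hJp0 := (hJ p hp).1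
      rcases special z₁ (z₂ + ser 0 1 α p) hz₁ (by linarith) ((dvd_sub hz (hdvd p)).trans (Eq.dvd (by ring))) with h | h <;> linarith
    · obtain ⟨h₁, h₂⟩ := eq_zero_of_invariant hr.ne' (hdet (t + 1)) (hdvd (t + 1))
        (hdvd (t + 2)) hI' hlt' (hJpos _ hq0 hq) hJt'.2 hz₁ hz₂ (by simpa using hz) hx
        (by linarith)
      obtain rfl : z₁ = 0 := by exact_mod_cast h₁
      obtain rfl : z₂ = 0 := by exact_mod_cast h₂
      exact Relation.ReflTransGen.refl
    · exfalso
      have hIp := hIanti (t + 2) p hpq hp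
      have hIp0 := (hInn p hp).trans (hIlt p hp).le
      rcases special (z₁ + ser r a α p) z₂ (by linarith) hz₂ (hz.trans (Eq.dvd (by ring))) with h | h <;> linarith

/-- every map `S_{i_p} -> S_{i_q}` with `q < p` can be seen in the diagram
of special Cohen-Macaulay modules. -/
theorem stmt_9 (r a n : ℕ) (α : ℕ → ℕ)
    (ha : 1 ≤ a) (har : a < r) (hcop : Nat.Coprime r a) (hn : 1 ≤ n)
    (hα : ∀ t, 1 ≤ t → t ≤ n → 2 ≤ α t)
    (hval : hj ((List.range n).map fun t => (α (t + 1) : ℚ)) = (r : ℚ) / (a : ℚ)) :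
    ∀ q p, q < p → p ≤ n → ∀ z₁ z₂ : ℕ,
      ((z₁ : ℤ) + (a : ℤ) * (z₂ : ℤ)) ≡ ser r a α q - ser r a α p [ZMOD (r : ℤ)] →
      HasPath r a n α p q z₁ z₂ := by
  intro q p hqp hp z₁ z₂ hz
  exact hasPath_of_dvd r a n α ha har hcop hn hα hval _ p q z₁ z₂ rfl hp (hqp.le.trans hp)
    hz.symm.dvd
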